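/- arXiv:2410.06732 — 3 statements merged into one kernel-verified Lean document; each statement's English description precedes it below -/
import Mathlib

section
/- Let κ > 0. Let u, v : [0,1] → ℂ be absolutely continuous with u(0)=u(1)=v(0)=v(1)=0 and u', v' ∈ L²(0,1), and assume u' is absolutely continuous. Let θ ∈ L²(0,1;ℂ) be locally absolutely continuous on (0,1] with θ(1)=0 and √a·θ' ∈ L²(0,1), and assume aθ' extends to an absolutely continuous function on [0,1] with (aθ')' ∈ L²(0,1), (aθ')(0) = 0, and u'' − κθ' ∈ L²(0,1). Then Re( ∫₀¹ v'(x) conj(u'(x)) dx + ∫₀¹ (u''(x) − κθ'(x)) conj(v(x)) dx + ∫₀¹ ((aθ')'(x) − κv'(x)) conj(θ(x)) dx ) = − ∫₀¹ a(x) |θ'(x)|² dx. -/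
open MeasureTheory Set intervalIntegral Filter Topology

local notation "conj'" => (starRingEnd ℂ)

/-- The primitive of an integrable complex function is absolutely continuous. -/
theorem IntervalIntegrable.absolutelyContinuousOnInterval_integral_complex {f : ℝ → ℂ} {a b : ℝ}
    (hf : IntervalIntegrable f volume a b) :
    AbsolutelyContinuousOnInterval (fun x => ∫ s in a..x, f s) a b := by
  have hre : IntervalIntegrable (fun x => (f x).re) volume a b := ⟨hf.1.re, hf.2.re⟩
  have him : IntervalIntegrable (fun x => (f x).im) volume a b := ⟨hf.1.im, hf.2.im⟩
  have hconst (c : ℂ) : AbsolutelyContinuousOnInterval (fun _ : ℝ => c) a b :=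
    (LipschitzWith.const c).lipschitzOnWith.absolutelyContinuousOnInterval
  have hsum := ((hre.absolutelyContinuousOnInterval_intervalIntegral left_mem_uIcc).fun_smul
    (hconst 1)).add ((him.absolutelyContinuousOnInterval_intervalIntegral left_mem_uIcc).fun_smul
    (hconst Complex.I))
  have heq : EqOn (fun x => ∫ s in a..x, f s)
      ((fun x => (∫ s in a..x, (f s).re) • (1 : ℂ)) +
        fun x => (∫ s in a..x, (f s).im) • Complex.I) (uIcc a b) := by
    intro x hx
    have hfx : IntervalIntegrable f volume a x := hf.mono_set (uIcc_subset_uIcc_left hx)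
    apply Complex.ext
    · simpa using (Complex.reCLM.intervalIntegral_comp_comm hfx).symm
    · simpa using (Complex.imCLM.intervalIntegral_comp_comm hfx).symm
  refine hsum.congr' ?_
  rw [EventuallyEq, eventually_inf_principal]
  refine Eventually.of_forall fun I hI => Finset.sum_congr rfl fun i hi => ?_
  rw [heq (hI.1 i hi).1, heq (hI.1 i hi).2]

/-- Integration by parts for primitives of integrable complex functions. -/
theorem integral_primitive_mul_add_mul_primitive {F G f g : ℝ → ℂ} {a b : ℝ}
    (hf : IntervalIntegrable f volume a b) (hg : IntervalIntegrable g volume a b)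
    (hF : ∀ x ∈ uIcc a b, F x = F a + ∫ s in a..x, f s)
    (hG : ∀ x ∈ uIcc a b, G x = G a + ∫ s in a..x, g s) :
    IntervalIntegrable (fun x => f x * G x) volume a b ∧
      IntervalIntegrable (fun x => F x * g x) volume a b ∧
      (∫ x in a..b, f x * G x) + ∫ x in a..b, F x * g x = F b * G b - F a * G a := by
  have hconst (c : ℂ) : AbsolutelyContinuousOnInterval (fun _ : ℝ => c) a b :=
    (LipschitzWith.const c).lipschitzOnWith.absolutelyContinuousOnInterval
  set P : ℝ → ℂ := (fun _ => F a) + fun x => ∫ s in a..x, f s with hP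
  set Q : ℝ → ℂ := (fun _ => G a) + fun x => ∫ s in a..x, g s with hQ
  have hPac : AbsolutelyContinuousOnInterval P a b :=
    (hconst _).add hf.absolutelyContinuousOnInterval_integral_complex
  have hQac : AbsolutelyContinuousOnInterval Q a b :=
    (hconst _).add hg.absolutelyContinuousOnInterval_integral_complex
  have hFc : ContinuousOn F (uIcc a b) := hPac.continuousOn.congr hF
  have hGc : ContinuousOn G (uIcc a b) := hQac.continuousOn.congr hG
  have hfG := hf.mul_continuousOn hGc
  have hFg := hg.continuousOn_mul hFc
  refine ⟨hfG, hFg, ?_⟩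
  have hsum := hfG.add hFg
  have hac := (hPac.smul hQac).sub hsum.absolutelyContinuousOnInterval_integral_complex
  obtain ⟨C, hC⟩ := hac.const_of_ae_hasDerivAt_zero (by
    filter_upwards [hf.ae_hasDerivAt_integral, hg.ae_hasDerivAt_integral,
      hsum.ae_hasDerivAt_integral] with x hfx hgx hsx hx
    have hPx : HasDerivAt P (f x) x := (hfx hx a left_mem_uIcc).const_add (F a)
    have hQx : HasDerivAt Q (g x) x := (hgx hx a left_mem_uIcc).const_add (G a)
    have hder := (hPx.mul hQx).sub (hsx hx a left_mem_uIcc)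
    have hPF : P x = F x := (hF x hx).symm
    have hQG : Q x = G x := (hG x hx).symm
    rw [hPF, hQG, sub_self] at hder
    exact hder)
  have hend := (hC b right_mem_uIcc).trans (hC a left_mem_uIcc).symm
  have hPb : P b = F b := (hF b right_mem_uIcc).symm
  have hQb : Q b = G b := (hG b right_mem_uIcc).symm
  have hPa : P a = F a := by simp [hP]
  have hQa : Q a = G a := by simp [hQ]
  simp only [Pi.sub_apply, smul_eq_mul, Pi.mul_apply, hPb, hQb, hPa, hQa,
    intervalIntegral.integral_same, sub_zero] at hend
  rw [← intervalIntegral.integral_add hfG hFg, ← hend]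
  ring

/-- Sesquilinear form of integration by parts for primitives of integrable complex functions. -/
theorem integral_primitive_mul_conj_add {F G f g : ℝ → ℂ} {a b : ℝ}
    (hf : IntervalIntegrable f volume a b) (hg : IntervalIntegrable g volume a b)
    (hF : ∀ x ∈ uIcc a b, F x = F a + ∫ s in a..x, f s)
    (hG : ∀ x ∈ uIcc a b, G x = G a + ∫ s in a..x, g s) :
    IntervalIntegrable (fun x => f x * conj' (G x)) volume a b ∧
      IntervalIntegrable (fun x => F x * conj' (g x)) volume a b ∧
      (∫ x in a..b, f x * conj' (G x)) + ∫ x in a..b, F x * conj' (g x)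
        = F b * conj' (G b) - F a * conj' (G a) := by
  have hconj : IntervalIntegrable (fun x => conj' (g x)) volume a b :=
    ⟨Complex.conjCLE.toContinuousLinearMap.integrable_comp hg.1,
      Complex.conjCLE.toContinuousLinearMap.integrable_comp hg.2⟩
  refine integral_primitive_mul_add_mul_primitive (G := fun x => conj' (G x)) hf hconj hF
    fun x hx => ?_
  have hgx : IntervalIntegrable g volume a x := hg.mono_set (uIcc_subset_uIcc_left hx)
  have hcomm := Complex.conjCLE.toContinuousLinearMap.intervalIntegral_comp_comm hgx
  simp only [ContinuousLinearEquiv.coe_coe, Complex.conjCLE_apply] at hcomm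
  rw [hG x hx, map_add, hcomm]

/-- `∫ f conj g` and `∫ g conj f` have the same real part. -/
theorem re_integral_mul_conj_comm (f g : ℝ → ℂ) (a b : ℝ) :
    (∫ x in a..b, f x * conj' (g x)).re = (∫ x in a..b, g x * conj' (f x)).re := by
  rw [← Complex.conj_re (∫ x in a..b, f x * conj' (g x)), ← intervalIntegral.intervalIntegral_conj]
  simp [mul_comm]

/-- (Strongly degenerate case.) Dissipativity identity:
`Re(∫₀¹ v' conj u' + ∫₀¹ (u'' − κθ') conj v + ∫₀¹ ((aθ')' − κv') conj θ) = −∫₀¹ a|θ'|²`. -/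
theorem stmt_5 (a : ℝ → ℝ)
    (haC1 : ContDiffOn ℝ 1 a (Icc (0:ℝ) 1))
    (ha0 : a 0 = 0)
    (hapos : ∀ x ∈ Ioc (0:ℝ) 1, 0 < a x)
    (hanotL1 : ¬ IntegrableOn (fun x => (a x)⁻¹) (Ioc (0:ℝ) 1) volume)
    (hasqrtL1 : IntegrableOn (fun x => (Real.sqrt (a x))⁻¹) (Ioc (0:ℝ) 1) volume)
    (κ : ℝ) (hκ : 0 < κ)
    (u u' u'' v v' θ θ' b b' : ℝ → ℂ)
    -- u is absolutely continuous with u(0)=u(1)=0 and u' ∈ L²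
    (hu'int : IntervalIntegrable u' volume 0 1)
    (huAC : ∀ x ∈ Icc (0:ℝ) 1, u x = u 0 + ∫ s in (0:ℝ)..x, u' s)
    (hu0 : u 0 = 0) (hu1 : u 1 = 0)
    (hu'L2 : MemLp u' 2 (volume.restrict (Ioc (0:ℝ) 1)))
    -- u' is absolutely continuous with a.e. derivative u''
    (hu''int : IntervalIntegrable u'' volume 0 1)
    (hu'AC : ∀ x ∈ Icc (0:ℝ) 1, u' x = u' 0 + ∫ s in (0:ℝ)..x, u'' s)
    -- v is absolutely continuous with v(0)=v(1)=0 and v' ∈ L²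
    (hv'int : IntervalIntegrable v' volume 0 1)
    (hvAC : ∀ x ∈ Icc (0:ℝ) 1, v x = v 0 + ∫ s in (0:ℝ)..x, v' s)
    (hv0 : v 0 = 0) (hv1 : v 1 = 0)
    (hv'L2 : MemLp v' 2 (volume.restrict (Ioc (0:ℝ) 1)))
    -- θ ∈ L²(0,1), locally absolutely continuous on (0,1], θ(1)=0, √a·θ' ∈ L²
    (hθL2 : MemLp θ 2 (volume.restrict (Ioc (0:ℝ) 1)))
    (hθ'locint : ∀ ε ∈ Ioc (0:ℝ) 1, IntervalIntegrable θ' volume ε 1)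
    (hθlocAC : ∀ x ∈ Ioc (0:ℝ) 1, θ x = θ 1 - ∫ s in x..(1:ℝ), θ' s)
    (hθ1 : θ 1 = 0)
    (hθ'L2 : MemLp (fun x => (Real.sqrt (a x) : ℂ) * θ' x) 2 (volume.restrict (Ioc (0:ℝ) 1)))
    -- aθ' extends to an absolutely continuous function b on [0,1] with b' ∈ L² and b 0 = 0
    (hb : ∀ x ∈ Ioc (0:ℝ) 1, b x = (a x : ℂ) * θ' x)
    (hb'int : IntervalIntegrable b' volume 0 1)
    (hbAC : ∀ x ∈ Icc (0:ℝ) 1, b x = b 0 + ∫ s in (0:ℝ)..x, b' s)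
    (hb'L2 : MemLp b' 2 (volume.restrict (Ioc (0:ℝ) 1)))
    (hb0 : b 0 = 0)
    -- u'' − κθ' ∈ L²
    (huθL2 : MemLp (fun x => u'' x - (κ : ℂ) * θ' x) 2 (volume.restrict (Ioc (0:ℝ) 1))) :
    ((∫ x in (0:ℝ)..1, v' x * conj' (u' x)) +
     (∫ x in (0:ℝ)..1, (u'' x - (κ : ℂ) * θ' x) * conj' (v x)) +
     (∫ x in (0:ℝ)..1, (b' x - (κ : ℂ) * v' x) * conj' (θ x))).re
      = - ∫ x in (0:ℝ)..1, a x * ‖θ' x‖ ^ 2 := by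
  have h01 : uIcc (0 : ℝ) 1 = Icc 0 1 := uIcc_of_le zero_le_one
  have hκ' : (κ : ℂ) ≠ 0 := by exact_mod_cast hκ.ne'
  have hθ'int : IntervalIntegrable θ' volume 0 1 := by
    have hdiff : IntervalIntegrable (fun x => u'' x - (κ : ℂ) * θ' x) volume 0 1 :=
      (intervalIntegrable_iff_integrableOn_Ioc_of_le zero_le_one).2
        (huθL2.integrable one_le_two)
    refine ((hu''int.sub hdiff).const_mul (κ : ℂ)⁻¹).congr fun x _ => ?_
    simp [hκ']
  -- The absolutely continuous representative of `θ` on `[0, 1]`.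
  set ϑ : ℝ → ℂ := fun x => -∫ s in x..(1:ℝ), θ' s with hϑdef
  have hθϑ : ∀ x ∈ Ioc (0:ℝ) 1, θ x = ϑ x := fun x hx => by
    rw [hθlocAC x hx, hθ1, zero_sub]
  have hϑ1 : ϑ 1 = 0 := by simp [hϑdef]
  have hϑAC : ∀ x ∈ uIcc (0:ℝ) 1, ϑ x = ϑ 0 + ∫ s in (0:ℝ)..x, θ' s := fun x hx => by
    have hadd := intervalIntegral.integral_add_adjacent_intervals
      (hθ'int.mono_set (uIcc_subset_uIcc_left hx)) (hθ'int.mono_set (uIcc_subset_uIcc_right hx))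
    simp only [hϑdef, ← hadd]
    ring
  rw [← h01] at hu'AC hvAC hbAC
  obtain ⟨hint_vu, hint_vu', hparts_vu⟩ :=
    integral_primitive_mul_conj_add hv'int hu''int hvAC hu'AC
  obtain ⟨hint_vϑ, hint_vϑ', hparts_vϑ⟩ :=
    integral_primitive_mul_conj_add hv'int hθ'int hvAC hϑAC
  obtain ⟨hint_uv, -, -⟩ := integral_primitive_mul_conj_add hu''int hv'int hu'AC hvAC
  obtain ⟨hint_ϑv, -, -⟩ := integral_primitive_mul_conj_add hθ'int hv'int hϑAC hvAC
  obtain ⟨hint_bϑ, -, hparts_bϑ⟩ :=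
    integral_primitive_mul_conj_add hb'int hθ'int hbAC hϑAC
  have hsecond : (∫ x in (0:ℝ)..1, (u'' x - (κ : ℂ) * θ' x) * conj' (v x)) =
      (∫ x in (0:ℝ)..1, u'' x * conj' (v x)) - κ * ∫ x in (0:ℝ)..1, θ' x * conj' (v x) := by
    rw [← intervalIntegral.integral_const_mul,
      ← intervalIntegral.integral_sub hint_uv (hint_ϑv.const_mul _)]
    simp only [sub_mul, mul_assoc]
  have hthird : (∫ x in (0:ℝ)..1, (b' x - (κ : ℂ) * v' x) * conj' (θ x)) =
      (∫ x in (0:ℝ)..1, b' x * conj' (ϑ x)) - κ * ∫ x in (0:ℝ)..1, v' x * conj' (ϑ x) := by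
    rw [← intervalIntegral.integral_const_mul,
      ← intervalIntegral.integral_sub hint_bϑ (hint_vϑ.const_mul _)]
    refine intervalIntegral.integral_congr_ae (Eventually.of_forall fun x hx => ?_)
    rw [uIoc_of_le zero_le_one] at hx
    simp only [hθϑ x hx, sub_mul, mul_assoc]
  have henergy : (∫ x in (0:ℝ)..1, b x * conj' (θ' x)) =
      ((∫ x in (0:ℝ)..1, a x * ‖θ' x‖ ^ 2 : ℝ) : ℂ) := by
    rw [← intervalIntegral.integral_ofReal]
    refine intervalIntegral.integral_congr_ae (Eventually.of_forall fun x hx => ?_)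
    rw [uIoc_of_le zero_le_one] at hx
    rw [hb x hx, mul_assoc, Complex.mul_conj']
    push_cast
    rfl
  rw [hv0, hv1, zero_mul, zero_mul, sub_zero] at hparts_vu hparts_vϑ
  rw [hϑ1, hb0, map_zero, mul_zero, zero_mul, sub_zero, henergy] at hparts_bϑ
  have hre_vu := congrArg Complex.re hparts_vu
  have hre_vϑ := congrArg Complex.re hparts_vϑ
  have hre_bϑ := congrArg Complex.re hparts_bϑ
  rw [Complex.add_re, Complex.zero_re, re_integral_mul_conj_comm v] at hre_vu hre_vϑ
  rw [Complex.add_re, Complex.zero_re, Complex.ofReal_re] at hre_bϑ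
  rw [hsecond, hthird]
  simp only [Complex.add_re, Complex.sub_re, Complex.re_ofReal_mul]
  linear_combination hre_vu - κ * hre_vϑ + hre_bϑ
end

section
/- Let κ > 0 and λ ∈ ℝ. Let u, v : [0,1] → ℂ be absolutely continuous with u(0)=u(1)=v(0)=v(1)=0 and u', v' ∈ L²(0,1), with u' absolutely continuous; let θ ∈ L²(0,1;ℂ) be locally absolutely continuous on (0,1] with θ(1)=0, √a·θ' ∈ L²(0,1), and aθ' extending to an absolutely continuous function on [0,1] with (aθ')' ∈ L²(0,1) and (aθ')(0) = 0. If v = iλu on [0,1], u'' − κθ' = iλv a.e. on (0,1), and (aθ')' − κv' = iλθ a.e. on (0,1), then u and v vanish identically on [0,1] and θ = 0 a.e. on (0,1). -/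
open MeasureTheory Set intervalIntegral Filter Topology

/-- The primitive of an interval integrable function is absolutely continuous. -/
theorem absolutelyContinuousOnInterval_primitive {E : Type*} [NormedAddCommGroup E]
    [NormedSpace ℝ E] {f : ℝ → E} {a b : ℝ} (hf : IntervalIntegrable f volume a b) :
    AbsolutelyContinuousOnInterval (fun x ↦ ∫ t in a..x, f t) a b := by
  have hnorm := hf.norm.absolutelyContinuousOnInterval_intervalIntegral (c := a) left_mem_uIcc
  have hsub : ∀ x ∈ uIcc a b, IntervalIntegrable f volume a x := fun x hx ↦
    hf.mono_set (uIcc_subset_uIcc left_mem_uIcc hx)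
  refine squeeze_zero' (Eventually.of_forall fun I ↦ Finset.sum_nonneg fun i _ ↦ dist_nonneg)
    ?_ hnorm
  filter_upwards [mem_inf_of_right (mem_principal_self _)] with I hI
  refine Finset.sum_le_sum fun i hi ↦ ?_
  have hmem := hI.1 i hi
  have h1 := hsub _ hmem.1
  have h2 := hsub _ hmem.2
  rw [dist_eq_norm, dist_eq_norm, integral_interval_sub_left h1 h2,
    integral_interval_sub_left h1.norm h2.norm, Real.norm_eq_abs]
  exact norm_integral_le_abs_integral_norm

/-- A function that is a primitive on `[a, b]` is continuous there. -/
theorem continuousOn_of_eq_add_integral {f f' : ℝ → ℂ} {a b : ℝ} (hab : a ≤ b)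
    (hf' : IntervalIntegrable f' volume a b)
    (hf : ∀ x ∈ Icc a b, f x = f a + ∫ s in a..x, f' s) : ContinuousOn f (Icc a b) := by
  have h := absolutelyContinuousOnInterval_primitive hf' |>.continuousOn
  rw [uIcc_of_le hab] at h
  exact (continuousOn_const.add h).congr hf

/-- Integration by parts for primitives of integrable functions. -/
theorem integral_mul_add_mul_of_eq_add_integral {f f' g g' : ℝ → ℂ} {a b : ℝ} (hab : a ≤ b)
    (hf' : IntervalIntegrable f' volume a b)
    (hf : ∀ x ∈ Icc a b, f x = f a + ∫ s in a..x, f' s)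
    (hg' : IntervalIntegrable g' volume a b)
    (hg : ∀ x ∈ Icc a b, g x = g a + ∫ s in a..x, g' s) :
    IntervalIntegrable (fun x ↦ f' x * g x + f x * g' x) volume a b ∧
      ∫ x in a..b, (f' x * g x + f x * g' x) = f b * g b - f a * g a := by
  have hfc := continuousOn_of_eq_add_integral hab hf' hf
  have hgc := continuousOn_of_eq_add_integral hab hg' hg
  have hint : IntervalIntegrable (fun x ↦ f' x * g x + f x * g' x) volume a b := by
    rw [← uIcc_of_le hab] at hfc hgc
    exact (hf'.mul_continuousOn hgc).add (hg'.continuousOn_mul hfc)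
  refine ⟨hint, ?_⟩
  have hconst (c : ℂ) : AbsolutelyContinuousOnInterval (fun _ ↦ c) a b :=
    ((LipschitzWith.const c).lipschitzOnWith (s := uIcc a b)).absolutelyContinuousOnInterval
  have hF := (hconst (f a)).fun_add (absolutelyContinuousOnInterval_primitive hf')
  have hG := (hconst (g a)).fun_add (absolutelyContinuousOnInterval_primitive hg')
  have hP := (hF.fun_smul hG).fun_sub (absolutelyContinuousOnInterval_primitive hint)
  obtain ⟨C, hC⟩ := hP.const_of_ae_hasDerivAt_zero (by
    filter_upwards [hf'.ae_hasDerivAt_integral, hg'.ae_hasDerivAt_integral,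
      hint.ae_hasDerivAt_integral] with x h1 h2 h3 hx
    have d1 := (h1 hx a left_mem_uIcc).const_add (f a)
    have d2 := (h2 hx a left_mem_uIcc).const_add (g a)
    have d3 := (d1.mul d2).sub (h3 hx a left_mem_uIcc)
    rw [uIcc_of_le hab] at hx
    convert! d3 using 1
    rw [hf x hx, hg x hx]
    ring)
  have ha := hC a left_mem_uIcc
  have hb := hC b right_mem_uIcc
  simp only [← hf b (right_mem_Icc.2 hab), ← hg b (right_mem_Icc.2 hab), integral_same, add_zero,
    sub_zero, smul_eq_mul] at ha hb
  rw [ha, ← hb]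
  ring

/-- Conjugation preserves being a primitive. -/
theorem conj_eq_add_integral {f f' : ℝ → ℂ} {a b : ℝ}
    (hf : ∀ x ∈ Icc a b, f x = f a + ∫ s in a..x, f' s) :
    ∀ x ∈ Icc a b, star (f x) = star (f a) + ∫ s in a..x, star (f' s) := by
  intro x hx
  have : ∫ s in a..x, star (f' s) = star (∫ s in a..x, f' s) := by
    simp only [intervalIntegral, ← starRingEnd_apply, integral_conj, map_sub]
  rw [this, hf x hx, star_add]

/-- Conjugation preserves interval integrability. -/
theorem intervalIntegrable_star {f : ℝ → ℂ} {a b : ℝ} (hf : IntervalIntegrable f volume a b) :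
    IntervalIntegrable (fun x ↦ star (f x)) volume a b := by
  have h : ∀ {s : Set ℝ}, IntegrableOn f s → IntegrableOn (fun x ↦ star (f x)) s := fun hs ↦
    Complex.conjCLE.toContinuousLinearMap.integrable_comp hs
  exact ⟨h hf.1, h hf.2⟩

/-- (Strongly degenerate case.) No purely imaginary eigenvalues:
if `v = iλu`, `u'' − κθ' = iλv` and `(aθ')' − κv' = iλθ`, then `u = v = 0` on `[0,1]`
and `θ = 0` a.e. on `(0,1)`. -/
theorem stmt_7 (a : ℝ → ℝ)
    (haC1 : ContDiffOn ℝ 1 a (Icc (0:ℝ) 1))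
    (ha0 : a 0 = 0)
    (hapos : ∀ x ∈ Ioc (0:ℝ) 1, 0 < a x)
    (hanotL1 : ¬ IntegrableOn (fun x => (a x)⁻¹) (Ioc (0:ℝ) 1) volume)
    (hasqrtL1 : IntegrableOn (fun x => (Real.sqrt (a x))⁻¹) (Ioc (0:ℝ) 1) volume)
    (κ : ℝ) (hκ : 0 < κ) (lam : ℝ)
    (u u' u'' v v' θ θ' b b' : ℝ → ℂ)
    (hu'int : IntervalIntegrable u' volume 0 1)
    (huAC : ∀ x ∈ Icc (0:ℝ) 1, u x = u 0 + ∫ s in (0:ℝ)..x, u' s)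
    (hu0 : u 0 = 0) (hu1 : u 1 = 0)
    (hu'L2 : MemLp u' 2 (volume.restrict (Ioc (0:ℝ) 1)))
    (hu''int : IntervalIntegrable u'' volume 0 1)
    (hu'AC : ∀ x ∈ Icc (0:ℝ) 1, u' x = u' 0 + ∫ s in (0:ℝ)..x, u'' s)
    (hv'int : IntervalIntegrable v' volume 0 1)
    (hvAC : ∀ x ∈ Icc (0:ℝ) 1, v x = v 0 + ∫ s in (0:ℝ)..x, v' s)
    (hv0 : v 0 = 0) (hv1 : v 1 = 0)
    (hv'L2 : MemLp v' 2 (volume.restrict (Ioc (0:ℝ) 1)))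
    -- θ ∈ L²(0,1), locally absolutely continuous on (0,1], θ(1)=0, √a·θ' ∈ L²
    (hθL2 : MemLp θ 2 (volume.restrict (Ioc (0:ℝ) 1)))
    (hθ'locint : ∀ ε ∈ Ioc (0:ℝ) 1, IntervalIntegrable θ' volume ε 1)
    (hθlocAC : ∀ x ∈ Ioc (0:ℝ) 1, θ x = θ 1 - ∫ s in x..(1:ℝ), θ' s)
    (hθ1 : θ 1 = 0)
    (hθ'L2 : MemLp (fun x => (Real.sqrt (a x) : ℂ) * θ' x) 2 (volume.restrict (Ioc (0:ℝ) 1)))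
    -- aθ' extends to an absolutely continuous function b on [0,1] with b' ∈ L², b 0 = 0
    (hb : ∀ x ∈ Ioc (0:ℝ) 1, b x = (a x : ℂ) * θ' x)
    (hb'int : IntervalIntegrable b' volume 0 1)
    (hbAC : ∀ x ∈ Icc (0:ℝ) 1, b x = b 0 + ∫ s in (0:ℝ)..x, b' s)
    (hb'L2 : MemLp b' 2 (volume.restrict (Ioc (0:ℝ) 1)))
    (hb0 : b 0 = 0)
    -- the eigenvalue system
    (heq1 : ∀ x ∈ Icc (0:ℝ) 1, v x = Complex.I * lam * u x)
    (heq2 : ∀ᵐ x ∂volume, x ∈ Ioo (0:ℝ) 1 →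
      u'' x - (κ : ℂ) * θ' x = Complex.I * lam * v x)
    (heq3 : ∀ᵐ x ∂volume, x ∈ Ioo (0:ℝ) 1 →
      b' x - (κ : ℂ) * v' x = Complex.I * lam * θ x) :
    (∀ x ∈ Icc (0:ℝ) 1, u x = 0 ∧ v x = 0) ∧
    (∀ᵐ x ∂volume, x ∈ Ioo (0:ℝ) 1 → θ x = 0) := by
  have h01 : (0:ℝ) ≤ 1 := zero_le_one
  have hκ' : (κ : ℂ) ≠ 0 := by exact_mod_cast hκ.ne'
  have hioc : ∀ {p : ℝ → Prop}, (∀ᵐ x, x ∈ Ioo (0:ℝ) 1 → p x) →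
      ∀ᵐ x, x ∈ Ioc (0:ℝ) 1 → p x := by
    intro p hp
    filter_upwards [hp, Measure.ae_ne volume (1:ℝ)] with x hx hne hmem
    exact hx ⟨hmem.1, lt_of_le_of_ne hmem.2 hne⟩
  have hnull : ∀ {f : ℝ → ℂ}, (∀ᵐ x, x ∈ Ioc (0:ℝ) 1 → f x = 0) →
      ∀ x ∈ Icc (0:ℝ) 1, ∫ s in (0:ℝ)..x, f s = 0 := by
    intro f hf x hx
    apply integral_zero_ae
    filter_upwards [hf] with s hs hmem
    rw [uIoc_of_le hx.1] at hmem
    exact hs ⟨hmem.1, hmem.2.trans hx.2⟩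
  replace heq2 := hioc heq2
  replace heq3 := hioc heq3
  have hvc : ContinuousOn v (uIcc 0 1) := by
    rw [uIcc_of_le h01]; exact continuousOn_of_eq_add_integral h01 hv'int hvAC
  -- the second equation makes `θ'` integrable up to the degenerate endpoint
  have hθ'int : IntervalIntegrable θ' volume 0 1 := by
    have h : IntervalIntegrable (fun x ↦ (κ : ℂ)⁻¹ * (u'' x - Complex.I * lam * v x))
        volume 0 1 :=
      (hu''int.sub (hvc.intervalIntegrable.const_mul _)).const_mul _
    refine h.congr_ae ?_
    rw [uIoc_of_le h01, EventuallyEq, ae_restrict_iff' measurableSet_Ioc]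
    filter_upwards [heq2] with x hx hmem
    rw [← hx hmem]
    field_simp
    ring
  set T : ℝ → ℂ := fun x ↦ -(∫ s in (0:ℝ)..1, θ' s) + ∫ s in (0:ℝ)..x, θ' s with hT
  have hTAC : ∀ x ∈ Icc (0:ℝ) 1, T x = T 0 + ∫ s in (0:ℝ)..x, θ' s := by
    intro x _
    simp [hT]
  have hT1 : T 1 = 0 := by simp [hT]
  have hTθ : ∀ x ∈ Ioc (0:ℝ) 1, θ x = T x := by
    intro x hx
    have h0x : IntervalIntegrable θ' volume 0 x :=
      hθ'int.mono_set (uIcc_subset_uIcc left_mem_uIcc (by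
        rw [uIcc_of_le h01]; exact ⟨hx.1.le, hx.2⟩))
    rw [hθlocAC x hx, hθ1, hT, ← integral_add_adjacent_intervals h0x (hθ'locint x hx)]
    ring
  obtain ⟨ibT, eibT⟩ := integral_mul_add_mul_of_eq_add_integral h01 hb'int hbAC
    (intervalIntegrable_star hθ'int) (conj_eq_add_integral hTAC)
  obtain ⟨ivT, eivT⟩ := integral_mul_add_mul_of_eq_add_integral h01 hv'int hvAC
    (intervalIntegrable_star hθ'int) (conj_eq_add_integral hTAC)
  obtain ⟨iu, eiu⟩ := integral_mul_add_mul_of_eq_add_integral h01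
    (intervalIntegrable_star hu''int) (conj_eq_add_integral hu'AC) hu'int huAC
  simp only [hb0, hT1, hv0, hu0, hu1, star_zero, mul_zero, zero_mul, sub_zero] at eibT eivT eiu
  set H : ℝ → ℂ := fun x ↦ (b' x * star (T x) + b x * star (θ' x))
    - (κ : ℂ) * (v' x * star (T x) + v x * star (θ' x))
    + Complex.I * lam * (star (u'' x) * u x + star (u' x) * u' x) with hH
  have iH : IntervalIntegrable H volume 0 1 :=
    (ibT.sub (ivT.const_mul _)).add (iu.const_mul _)
  have eH : ∫ x in (0:ℝ)..1, H x = 0 := by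
    rw [hH, integral_add (ibT.sub (ivT.const_mul _)) (iu.const_mul _),
      integral_sub ibT (ivT.const_mul _), intervalIntegral.integral_const_mul,
      intervalIntegral.integral_const_mul, eibT, eivT, eiu]
    simp
  have hHre : ∀ᵐ x, x ∈ Ioc (0:ℝ) 1 → (H x).re = a x * Complex.normSq (θ' x) := by
    filter_upwards [heq2, heq3] with x h2 h3 hx
    have hx' : x ∈ Icc (0:ℝ) 1 := Ioc_subset_Icc_self hx
    have e2 : star (u'' x) = κ * star (θ' x) + star (Complex.I * lam * v x) := by
      rw [← h2 hx]
      simp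
    have e3 : b' x = κ * v' x + Complex.I * lam * T x := by
      rw [← hTθ x hx, ← h3 hx]
      ring
    simp only [hH, e2, e3, hb x hx, heq1 x hx']
    simp only [Complex.star_def, Complex.normSq_apply, Complex.add_re, Complex.sub_re,
      Complex.mul_re, Complex.mul_im, Complex.add_im, Complex.conj_re,
      Complex.conj_im, Complex.I_re, Complex.I_im, Complex.ofReal_re, Complex.ofReal_im]
    ring
  have eHre : ∫ x in Ioc (0:ℝ) 1, (H x).re = 0 := by
    have h := integral_re (𝕜 := ℂ) iH.1
    rw [integral_of_le h01] at eH
    simpa [eH] using h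
  have hre0 : ∀ᵐ x, x ∈ Ioc (0:ℝ) 1 → (H x).re = 0 := by
    have h := (setIntegral_eq_zero_iff_of_nonneg_ae (μ := volume) (s := Ioc (0:ℝ) 1)
      (f := fun x ↦ (H x).re) (by
        rw [EventuallyLE, ae_restrict_iff' measurableSet_Ioc]
        filter_upwards [hHre] with x hx hmem
        rw [hx hmem]
        exact mul_nonneg (hapos x hmem).le (Complex.normSq_nonneg _)) iH.1.re).1 eHre
    rwa [EventuallyEq, ae_restrict_iff' measurableSet_Ioc] at h
  have hθ'0 : ∀ᵐ x, x ∈ Ioc (0:ℝ) 1 → θ' x = 0 := by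
    filter_upwards [hHre, hre0] with x h1 h2 hx
    have h := (h1 hx).symm.trans (h2 hx)
    exact Complex.normSq_eq_zero.1 ((mul_eq_zero.1 h).resolve_left (hapos x hx).ne')
  have hθ0 : ∀ x ∈ Ioc (0:ℝ) 1, θ x = 0 := by
    intro x hx
    simp only [hTθ x hx, hT, hnull hθ'0 x (Ioc_subset_Icc_self hx),
      hnull hθ'0 1 (right_mem_Icc.2 h01), neg_zero, add_zero]
  have hbv : ∀ x ∈ Icc (0:ℝ) 1, b x = κ * v x := by
    intro x hx
    have hsub : uIcc 0 x ⊆ uIcc (0:ℝ) 1 :=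
      uIcc_subset_uIcc left_mem_uIcc (by rwa [uIcc_of_le h01])
    have h := hnull (f := fun s ↦ b' s - κ * v' s) (by
      filter_upwards [heq3] with s hs hmem
      rw [hs hmem, hθ0 s hmem, mul_zero]) x hx
    rw [integral_sub (hb'int.mono_set hsub) ((hv'int.mono_set hsub).const_mul _),
      intervalIntegral.integral_const_mul, sub_eq_zero] at h
    rw [hbAC x hx, hvAC x hx, hb0, hv0, zero_add, zero_add, h]
  have hu''0 : ∀ᵐ x, x ∈ Ioc (0:ℝ) 1 → u'' x = 0 := by
    filter_upwards [hθ'0, heq2] with x h1 h2 hx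
    have hvx : v x = 0 := by
      have h := hbv x (Ioc_subset_Icc_self hx)
      rw [hb x hx, h1 hx, mul_zero] at h
      exact (mul_eq_zero.1 h.symm).resolve_left hκ'
    simpa [h1 hx, hvx] using h2 hx
  have hu'c : ∀ x ∈ Icc (0:ℝ) 1, u' x = u' 0 := by
    intro x hx
    rw [hu'AC x hx, hnull hu''0 x hx, add_zero]
  have hulin : ∀ x ∈ Icc (0:ℝ) 1, u x = x * u' 0 := by
    intro x hx
    have h : ∫ s in (0:ℝ)..x, u' s = ∫ _ in (0:ℝ)..x, u' 0 := by
      apply integral_congr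
      intro s hs
      rw [uIcc_of_le hx.1] at hs
      exact hu'c s ⟨hs.1, hs.2.trans hx.2⟩
    rw [huAC x hx, hu0, h, intervalIntegral.integral_const]
    simp
  have hu'0 : u' 0 = 0 := by
    simpa [hu1] using (hulin 1 (right_mem_Icc.2 h01)).symm
  have hu : ∀ x ∈ Icc (0:ℝ) 1, u x = 0 := by
    intro x hx
    rw [hulin x hx, hu'0, mul_zero]
  refine ⟨fun x hx ↦ ⟨hu x hx, by rw [heq1 x hx, hu x hx, mul_zero]⟩, ?_⟩
  exact Eventually.of_forall fun x hx ↦ hθ0 x (Ioo_subset_Ioc_self hx)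
end

section
/- Let κ > 0. There exists a constant C > 0, depending only on κ, such that the following holds for every λ ∈ ℝ: if u : [0,1] → ℂ is absolutely continuous with u' ∈ L²(0,1), θ ∈ L²(0,1;ℂ) is locally absolutely continuous on (0,1], G ∈ L²(0,1;ℂ), and aθ' extends to an absolutely continuous function on [0,1] with (aθ')' ∈ L²(0,1) satisfying (aθ')' − iκλu' − iλθ = G a.e. on (0,1), then |(aθ')(0)|² ≤ C( ‖aθ'‖² + |λ|·‖u'‖·‖aθ'‖ + |λ|·‖θ‖·‖aθ'‖ + ‖G‖·‖aθ'‖ ), where ‖·‖ denotes the L²(0,1) norm. -/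
open MeasureTheory Set intervalIntegral Filter Topology

/-- The `L²(0,1)` norm. -/
noncomputable def L2norm (f : ℝ → ℂ) : ℝ := (∫ x in (0:ℝ)..1, ‖f x‖ ^ 2) ^ ((1:ℝ)/2)

/-- The primitive of an integrable function is absolutely continuous, with the expected
derivative almost everywhere. -/
lemma IntervalIntegrable.absolutelyContinuousOnInterval_const_add_integral {f : ℝ → ℝ}
    (hf : IntervalIntegrable f volume 0 1) (c : ℝ) :
    AbsolutelyContinuousOnInterval (fun x ↦ c + ∫ s in (0:ℝ)..x, f s) 0 1 ∧
      ∀ᵐ x, x ∈ uIcc (0:ℝ) 1 → HasDerivAt (fun x ↦ c + ∫ s in (0:ℝ)..x, f s) (f x) x := by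
  constructor
  · have hc : AbsolutelyContinuousOnInterval (fun _ : ℝ ↦ c) 0 1 :=
      contDiff_const.contDiffOn.absolutelyContinuousOnInterval
    exact hc.fun_add (hf.absolutelyContinuousOnInterval_intervalIntegral (by simp))
  · filter_upwards [hf.ae_hasDerivAt_integral] with x hx hmem
    exact (hx hmem 0 (by simp)).const_add c

lemma continuousOn_of_eq_integral {b b' : ℝ → ℂ} (hb' : IntervalIntegrable b' volume 0 1)
    (hb : ∀ x ∈ Icc (0:ℝ) 1, b x = b 0 + ∫ s in (0:ℝ)..x, b' s) :
    ContinuousOn b (Icc 0 1) := by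
  have h : ContinuousOn (fun x ↦ ∫ s in (0:ℝ)..x, b' s) (uIcc 0 1) :=
    continuousOn_primitive_interval' hb' (by simp)
  rw [uIcc_of_le zero_le_one] at h
  exact (continuousOn_const.add h).congr hb

/-- Trace inequality at the left endpoint, from integrating the derivative of
`(x - 1) * ‖b x‖ ^ 2`. -/
lemma sq_norm_left_le_integral {b b' : ℝ → ℂ} (hb' : IntervalIntegrable b' volume 0 1)
    (hb : ∀ x ∈ Icc (0:ℝ) 1, b x = b 0 + ∫ s in (0:ℝ)..x, b' s) :
    ‖b 0‖ ^ 2 ≤ ∫ x in (0:ℝ)..1, (‖b x‖ ^ 2 + 2 * (‖b x‖ * ‖b' x‖)) := by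
  have hcont : ContinuousOn (fun x ↦ ‖b x‖) (uIcc 0 1) := by
    rw [uIcc_of_le zero_le_one]
    exact (continuousOn_of_eq_integral hb' hb).norm
  have hre' : IntervalIntegrable (fun x ↦ (b' x).re) volume 0 1 :=
    ⟨hb'.1.re, hb'.2.re⟩
  have him' : IntervalIntegrable (fun x ↦ (b' x).im) volume 0 1 :=
    ⟨hb'.1.im, hb'.2.im⟩
  obtain ⟨hRac, hRd⟩ := hre'.absolutelyContinuousOnInterval_const_add_integral (b 0).re
  obtain ⟨hIac, hId⟩ := him'.absolutelyContinuousOnInterval_const_add_integral (b 0).im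
  set R : ℝ → ℝ := fun x ↦ (b 0).re + ∫ s in (0:ℝ)..x, (b' s).re with hR
  set J : ℝ → ℝ := fun x ↦ (b 0).im + ∫ s in (0:ℝ)..x, (b' s).im with hJ
  have hsub (x : ℝ) (hx : x ∈ Icc (0:ℝ) 1) : IntervalIntegrable b' volume 0 x :=
    hb'.mono_set (by
      rw [uIcc_of_le hx.1, uIcc_of_le zero_le_one]; exact Icc_subset_Icc_right hx.2)
  have hRe (x : ℝ) (hx : x ∈ Icc (0:ℝ) 1) : R x = (b x).re := by
    rw [hb x hx, Complex.add_re]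
    exact congrArg _ (Complex.reCLM.intervalIntegral_comp_comm (hsub x hx))
  have hIm (x : ℝ) (hx : x ∈ Icc (0:ℝ) 1) : J x = (b x).im := by
    rw [hb x hx, Complex.add_im]
    exact congrArg _ (Complex.imCLM.intervalIntegral_comp_comm (hsub x hx))
  have hlin : AbsolutelyContinuousOnInterval (fun x : ℝ ↦ x - 1) 0 1 :=
    (contDiff_id.sub contDiff_const).contDiffOn.absolutelyContinuousOnInterval
  have hPac := hlin.fun_mul ((hRac.fun_mul hRac).fun_add (hIac.fun_mul hIac))
  have hftc := hPac.integral_deriv_eq_sub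
  have hval : ‖b 0‖ ^ 2 = R 0 * R 0 + J 0 * J 0 := by
    simp [hR, hJ, Complex.sq_norm, Complex.normSq_apply]
  have hend : ‖b 0‖ ^ 2 = ∫ x in (0:ℝ)..1,
      deriv (fun x ↦ (x - 1) * (R x * R x + J x * J x)) x := by
    rw [hftc, hval]; ring
  rw [hend]
  refine intervalIntegral.integral_mono_ae_restrict zero_le_one hPac.intervalIntegrable_deriv
    ((hcont.pow 2).intervalIntegrable.add
      ((hb'.norm.continuousOn_mul hcont).const_mul 2)) ?_
  refine (ae_restrict_iff' measurableSet_Icc).2 ?_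
  filter_upwards [hRd, hId] with x hxR hxJ hx
  have hx' : x ∈ uIcc (0:ℝ) 1 := by rwa [uIcc_of_le zero_le_one]
  have hdR := hxR hx'
  have hdJ := hxJ hx'
  have hd := (((hasDerivAt_id x).sub_const 1).mul ((hdR.mul hdR).add (hdJ.mul hdJ))).deriv
  have hder : deriv (fun x ↦ (x - 1) * (R x * R x + J x * J x)) x =
      ‖b x‖ ^ 2 + 2 * ((x - 1) * ((b x).re * (b' x).re + (b x).im * (b' x).im)) := by
    rw [← hRe x hx, ← hIm x hx, Complex.sq_norm, Complex.normSq_apply, ← hRe x hx, ← hIm x hx]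
    refine hd.trans ?_
    simp only [Pi.add_apply, Pi.mul_apply, id]
    ring
  have hinner : |(b x).re * (b' x).re + (b x).im * (b' x).im| ≤ ‖b x‖ * ‖b' x‖ := by
    have h := Complex.abs_re_le_norm (b x * (starRingEnd ℂ) (b' x))
    simpa using h
  have hweight : |x - 1| ≤ 1 := abs_le.2 ⟨by linarith [hx.1], by linarith [hx.2]⟩
  change deriv _ x ≤ ‖b x‖ ^ 2 + 2 * (‖b x‖ * ‖b' x‖)
  rw [hder]
  refine add_le_add_right (mul_le_mul_of_nonneg_left ?_ zero_le_two) _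
  calc _ ≤ |(x - 1) * ((b x).re * (b' x).re + (b x).im * (b' x).im)| := le_abs_self _
    _ ≤ 1 * (‖b x‖ * ‖b' x‖) := by rw [abs_mul]; gcongr
    _ = _ := one_mul _

lemma L2norm_sq (f : ℝ → ℂ) : L2norm f ^ 2 = ∫ x in (0:ℝ)..1, ‖f x‖ ^ 2 := by
  have h : 0 ≤ ∫ x in (0:ℝ)..1, ‖f x‖ ^ 2 :=
    integral_nonneg zero_le_one fun x _ ↦ by positivity
  rw [L2norm, ← Real.sqrt_eq_rpow, Real.sq_sqrt h]

lemma L2norm_nonneg (f : ℝ → ℂ) : 0 ≤ L2norm f := by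
  rw [L2norm, ← Real.sqrt_eq_rpow]
  exact Real.sqrt_nonneg _

/-- The Cauchy–Schwarz inequality on `(0,1)`. -/
lemma integral_norm_mul_norm_le_L2norm {f g : ℝ → ℂ}
    (hf : MemLp f 2 (volume.restrict (Ioc (0:ℝ) 1)))
    (hg : MemLp g 2 (volume.restrict (Ioc (0:ℝ) 1))) :
    ∫ x in (0:ℝ)..1, ‖f x‖ * ‖g x‖ ≤ L2norm f * L2norm g := by
  have h := integral_mul_norm_le_Lp_mul_Lq Real.HolderConjugate.two_two
    (μ := volume.restrict (Ioc (0:ℝ) 1)) (f := f) (g := g) (by simpa using hf) (by simpa using hg)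
  simpa [L2norm, integral_of_le] using h

/-- Boundary trace estimate for the thermal component: there is `C > 0`
depending only on `κ` such that any solution of `(aθ')' − iκλu' − iλθ = G` satisfies
`|(aθ')(0)|² ≤ C(‖aθ'‖² + |λ|‖u'‖‖aθ'‖ + |λ|‖θ‖‖aθ'‖ + ‖G‖‖aθ'‖)`. -/
theorem stmt_16 (κ : ℝ) (hκ : 0 < κ) :
    ∃ C > (0:ℝ), ∀ (lam : ℝ) (a : ℝ → ℝ) (u u' θ θ' G b b' : ℝ → ℂ),
      -- a continuous on [0,1], a(0) = 0, a > 0 on (0,1]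
      ContinuousOn a (Icc (0:ℝ) 1) → a 0 = 0 → (∀ x ∈ Ioc (0:ℝ) 1, 0 < a x) →
      -- u absolutely continuous with u' ∈ L²
      IntervalIntegrable u' volume 0 1 →
      (∀ x ∈ Icc (0:ℝ) 1, u x = u 0 + ∫ s in (0:ℝ)..x, u' s) →
      MemLp u' 2 (volume.restrict (Ioc (0:ℝ) 1)) →
      -- θ ∈ L², locally absolutely continuous on (0,1]
      MemLp θ 2 (volume.restrict (Ioc (0:ℝ) 1)) →
      (∀ ε ∈ Ioc (0:ℝ) 1, IntervalIntegrable θ' volume ε 1) →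
      (∀ x ∈ Ioc (0:ℝ) 1, θ x = θ 1 - ∫ s in x..(1:ℝ), θ' s) →
      -- G ∈ L²
      MemLp G 2 (volume.restrict (Ioc (0:ℝ) 1)) →
      -- aθ' extends to an absolutely continuous function b on [0,1] with b' ∈ L²
      (∀ x ∈ Ioc (0:ℝ) 1, b x = (a x : ℂ) * θ' x) →
      IntervalIntegrable b' volume 0 1 →
      (∀ x ∈ Icc (0:ℝ) 1, b x = b 0 + ∫ s in (0:ℝ)..x, b' s) →
      MemLp b' 2 (volume.restrict (Ioc (0:ℝ) 1)) →
      -- the equation (aθ')' − iκλu' − iλθ = G a.e. on (0,1)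
      (∀ᵐ x ∂volume, x ∈ Ioo (0:ℝ) 1 →
        b' x - Complex.I * κ * lam * u' x - Complex.I * lam * θ x = G x) →
      ‖b 0‖ ^ 2
        ≤ C * (L2norm b ^ 2
            + |lam| * L2norm u' * L2norm b
            + |lam| * L2norm θ * L2norm b
            + L2norm G * L2norm b) := by
  refine ⟨2 + 2 * κ, by positivity, ?_⟩
  intro lam a u u' θ θ' G b b' _ _ _ _ _ hu' hθ _ _ hG _ hb' hb hbL' heq
  have hbL : MemLp b 2 (volume.restrict (Ioc (0:ℝ) 1)) := by
    have hcont := continuousOn_of_eq_integral hb' hb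
    obtain ⟨M, hM⟩ := isCompact_Icc.exists_bound_of_continuousOn hcont
    refine MemLp.of_bound
      ((hcont.mono Ioc_subset_Icc_self).aestronglyMeasurable measurableSet_Ioc) M ?_
    exact (ae_restrict_iff' measurableSet_Ioc).2
      (.of_forall fun x hx ↦ hM x (Ioc_subset_Icc_self hx))
  have hbmul {f : ℝ → ℂ} (hf : MemLp f 2 (volume.restrict (Ioc (0:ℝ) 1))) :
      IntervalIntegrable (fun x ↦ ‖b x‖ * ‖f x‖) volume 0 1 :=
    (intervalIntegrable_iff_integrableOn_Ioc_of_le zero_le_one).2 (hbL.norm.integrable_mul hf.norm)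
  have hsq : IntervalIntegrable (fun x ↦ ‖b x‖ ^ 2) volume 0 1 := by
    simpa only [pow_two] using hbmul hbL
  have hiu := (hbmul hu').const_mul (κ * |lam|)
  have hiθ := (hbmul hθ).const_mul |lam|
  have hbound : ∫ x in (0:ℝ)..1, (‖b x‖ ^ 2 + 2 * (‖b x‖ * ‖b' x‖)) ≤
      ∫ x in (0:ℝ)..1, (‖b x‖ ^ 2 + 2 * (κ * |lam| * (‖b x‖ * ‖u' x‖) +
        |lam| * (‖b x‖ * ‖θ x‖) + ‖b x‖ * ‖G x‖)) := by
    refine intervalIntegral.integral_mono_ae_restrict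
      zero_le_one (hsq.add ((hbmul hbL').const_mul 2))
      (hsq.add (((hiu.add hiθ).add (hbmul hG)).const_mul 2)) ?_
    rw [← restrict_Ioo_eq_restrict_Icc]
    refine (ae_restrict_iff' measurableSet_Ioo).2 ?_
    filter_upwards [heq] with x hx hmem
    have hb'x : ‖b' x‖ ≤ κ * |lam| * ‖u' x‖ + |lam| * ‖θ x‖ + ‖G x‖ := by
      have h : b' x = Complex.I * κ * lam * u' x + Complex.I * lam * θ x + G x := by
        rw [← hx hmem]; ring
      rw [h]
      refine (norm_add₃_le).trans_eq ?_
      simp [abs_of_pos hκ]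
    have h := mul_le_mul_of_nonneg_left hb'x (norm_nonneg (b x))
    linarith
  have hsplit : ∫ x in (0:ℝ)..1, (‖b x‖ ^ 2 + 2 * (κ * |lam| * (‖b x‖ * ‖u' x‖) +
        |lam| * (‖b x‖ * ‖θ x‖) + ‖b x‖ * ‖G x‖)) =
      L2norm b ^ 2 + 2 * (κ * |lam| * (∫ x in (0:ℝ)..1, ‖b x‖ * ‖u' x‖) +
        |lam| * (∫ x in (0:ℝ)..1, ‖b x‖ * ‖θ x‖) + ∫ x in (0:ℝ)..1, ‖b x‖ * ‖G x‖) := by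
    rw [integral_add hsq (((hiu.add hiθ).add (hbmul hG)).const_mul 2),
      intervalIntegral.integral_const_mul, integral_add (hiu.add hiθ) (hbmul hG),
      integral_add hiu hiθ, intervalIntegral.integral_const_mul,
      intervalIntegral.integral_const_mul, L2norm_sq]
  have hmain := (sq_norm_left_le_integral hb' hb).trans (hbound.trans_eq hsplit)
  have hCSu := mul_le_mul_of_nonneg_left (integral_norm_mul_norm_le_L2norm hbL hu')
    (by positivity : 0 ≤ κ * |lam|)
  have hCSθ := mul_le_mul_of_nonneg_left (integral_norm_mul_norm_le_L2norm hbL hθ) (abs_nonneg lam)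
  have hCSG := integral_norm_mul_norm_le_L2norm hbL hG
  have hnb := L2norm_nonneg b
  have hu0 : 0 ≤ |lam| * L2norm u' * L2norm b :=
    mul_nonneg (mul_nonneg (abs_nonneg _) (L2norm_nonneg _)) hnb
  have hθ0 : 0 ≤ κ * (|lam| * L2norm θ * L2norm b) :=
    mul_nonneg hκ.le (mul_nonneg (mul_nonneg (abs_nonneg _) (L2norm_nonneg _)) hnb)
  have hG0 : 0 ≤ κ * (L2norm G * L2norm b) :=
    mul_nonneg hκ.le (mul_nonneg (L2norm_nonneg _) hnb)
  have hb0 : 0 ≤ κ * L2norm b ^ 2 := by positivity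
  linarith [sq_nonneg (L2norm b)]
end
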